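/- arXiv:2511.17157 — 3 statements merged into one kernel-verified Lean document; each statement's English description precedes it below -/
import Mathlib

section
/- Let E = ℝⁿ with the Euclidean norm, let f : E → ℝ be convex and differentiable, and suppose there is L ≥ 0 such that f(x') ≤ f(x) + ⟨∇f(x), x' − x⟩ + (L/2)·‖x' − x‖² for all x, x' ∈ E. Let θ ∈ [0, 1], let x_ag, x̂, x⁺ ∈ E, and define x_md = (1 − θ)·x_ag + θ·x̂ and x_ag⁺ = (1 − θ)·x_ag + θ·x⁺. Then for every x ∈ E: f(x_ag⁺) − f(x) ≤ (1 − θ)·(f(x_ag) − f(x)) + θ·⟨∇f(x_md), x⁺ − x⟩ + (L·θ²/2)·‖x̂ − x⁺‖². -/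
open scoped RealInnerProductSpace

/-- The first-order lower bound for a convex function with a gradient at `x`. -/
theorem ConvexOn.add_inner_le_of_hasGradientAt {E : Type*} [NormedAddCommGroup E]
    [InnerProductSpace ℝ E] [CompleteSpace E] {f : E → ℝ} {g x : E}
    (hf : ConvexOn ℝ Set.univ f) (hg : HasGradientAt f g x) (y : E) :
    f x + ⟪g, y - x⟫ ≤ f y := by
  have hline : ConvexOn ℝ Set.univ (f ∘ AffineMap.lineMap (k := ℝ) x y) :=
    hf.comp_affineMap _
  have hderiv : HasDerivAt (f ∘ AffineMap.lineMap (k := ℝ) x y) ⟪g, y - x⟫ 0 := by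
    have hx : HasFDerivAt f (InnerProductSpace.toDual ℝ E g)
        (AffineMap.lineMap x y (0 : ℝ)) := by
      simpa using hg.hasFDerivAt
    simpa using hx.comp_hasDerivAt (0 : ℝ) AffineMap.hasDerivAt_lineMap
  have hslope := hline.le_slope_of_hasDerivAt (Set.mem_univ 0) (Set.mem_univ 1)
    zero_lt_one hderiv
  simp only [slope_def_field, Function.comp_apply, AffineMap.lineMap_apply_zero,
    AffineMap.lineMap_apply_one, sub_zero, div_one] at hslope
  linarith

theorem smooth_convex_interpolation_step {n : ℕ}
    (f : EuclideanSpace ℝ (Fin n) → ℝ) (f' : EuclideanSpace ℝ (Fin n) → EuclideanSpace ℝ (Fin n))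
    (hdiff : ∀ x, HasGradientAt f (f' x) x)
    (hconv : ConvexOn ℝ Set.univ f)
    (L : ℝ) (hL : 0 ≤ L)
    (hsmooth : ∀ x x', f x' ≤ f x + ⟪f' x, x' - x⟫ + L / 2 * ‖x' - x‖ ^ 2)
    (θ : ℝ) (hθ : θ ∈ Set.Icc (0 : ℝ) 1)
    (xag xhat xplus xmd xagp : EuclideanSpace ℝ (Fin n))
    (hmd : xmd = (1 - θ) • xag + θ • xhat)
    (hagp : xagp = (1 - θ) • xag + θ • xplus) :
    ∀ x : EuclideanSpace ℝ (Fin n),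
      f xagp - f x ≤ (1 - θ) * (f xag - f x) + θ * ⟪f' xmd, xplus - x⟫
        + L * θ ^ 2 / 2 * ‖xhat - xplus‖ ^ 2 := by
  intro x
  obtain ⟨hθ₀, hθ₁⟩ := hθ
  have hag := mul_le_mul_of_nonneg_left
    (hconv.add_inner_le_of_hasGradientAt (hdiff xmd) xag) (sub_nonneg.2 hθ₁)
  have hx := mul_le_mul_of_nonneg_left
    (hconv.add_inner_le_of_hasGradientAt (hdiff xmd) x) hθ₀
  have hupper := hsmooth xmd xagp
  have hnorm : ‖xagp - xmd‖ ^ 2 = θ ^ 2 * ‖xhat - xplus‖ ^ 2 := by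
    have hsub : xagp - xmd = θ • (xplus - xhat) := by rw [hagp, hmd]; module
    rw [hsub, norm_smul, mul_pow, norm_sub_rev, Real.norm_eq_abs, sq_abs]
  have hinner : ⟪f' xmd, xagp - xmd⟫ = (1 - θ) * ⟪f' xmd, xag - xmd⟫
      + θ * ⟪f' xmd, x - xmd⟫ + θ * ⟪f' xmd, xplus - x⟫ := by
    simp only [← real_inner_smul_right, ← inner_add_right]
    congr 1
    rw [hagp]
    module
  rw [hnorm, hinner] at hupper
  linarith
end

section
/- Consider the composite problem min_{x ∈ ℝⁿ} F(x) = f(x) + g(x), where f : ℝⁿ → ℝ is convex and differentiable with f(x') ≤ f(x) + ⟨∇f(x), x' − x⟩ + (L/2)‖x' − x‖² for all x, x' (L ≥ 0), and g : ℝⁿ → ℝ is convex. Let x* be a minimizer of F. Fix γ > 0 with α := L/γ ∈ (0, 1], fix t ≥ 1, and set θ = 1/t and τ = γ·θ. Given points x_ag, x̂ ∈ ℝⁿ, define x_md = (1 − θ)·x_ag + θ·x̂, let x⁺ be a minimizer over ℝⁿ of x ↦ g(x) + (τ/2)·‖x − (x̂ − (1/τ)·∇f(x_md))‖², and set x_ag⁺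 = (1 − θ)·x_ag + θ·x⁺. Then t²·(F(x_ag⁺) − F(x*)) ≤ t·(t − 1)·(F(x_ag) − F(x*)) + (γ/2)·(‖x̂ − x*‖² − ‖x⁺ − x*‖² − (1 − α)·‖x̂ − x⁺‖²). -/
open scoped RealInnerProductSpace

section

variable {E : Type*} [NormedAddCommGroup E] [InnerProductSpace ℝ E]

/-- A convex function lies above its tangent hyperplanes. -/
theorem ConvexOn.add_inner_gradient_le [CompleteSpace E] {f : E → ℝ}
    (hf : ConvexOn ℝ Set.univ f) {x v : E} (hv : HasGradientAt f v x) (y : E) :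
    f x + ⟪v, y - x⟫ ≤ f y := by
  have hconv : ConvexOn ℝ Set.univ (f ∘ AffineMap.lineMap (k := ℝ) x y) := by
    simpa using hf.comp_affineMap (AffineMap.lineMap (k := ℝ) x y)
  have hderiv : HasDerivAt (f ∘ AffineMap.lineMap (k := ℝ) x y) ⟪v, y - x⟫ 0 := by
    have hv' : HasFDerivAt f (InnerProductSpace.toDual ℝ E v)
        (AffineMap.lineMap (k := ℝ) x y 0) := by
      simpa using hv.hasFDerivAt
    simpa using hv'.comp_hasDerivAt (0 : ℝ) AffineMap.hasDerivAt_lineMap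
  have h := hconv.le_slope_of_hasDerivAt (Set.mem_univ 0) (Set.mem_univ 1) one_pos hderiv
  simp [slope_def_field] at h
  linarith

/-- The three-point inequality for a proximal step with center `c` and weight `τ / 2`. -/
theorem ConvexOn.prox_three_point {g : E → ℝ} (hg : ConvexOn ℝ Set.univ g) {τ : ℝ} {c p : E}
    (hp : ∀ x, g p + τ / 2 * ‖p - c‖ ^ 2 ≤ g x + τ / 2 * ‖x - c‖ ^ 2) (y : E) :
    g p + τ / 2 * ‖p - c‖ ^ 2 + τ / 2 * ‖y - p‖ ^ 2 ≤ g y + τ / 2 * ‖y - c‖ ^ 2 := by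
  have key : ∀ s ∈ Set.Ioo (0 : ℝ) 1, g p + τ / 2 * ‖p - c‖ ^ 2 +
      (1 - s) * (τ / 2 * ‖y - p‖ ^ 2) ≤ g y + τ / 2 * ‖y - c‖ ^ 2 := by
    rintro s ⟨hs0, hs1⟩
    have hconv : g ((1 - s) • p + s • y) ≤ (1 - s) * g p + s * g y :=
      hg.2 (Set.mem_univ p) (Set.mem_univ y) (by linarith) hs0.le (by ring)
    have hnorm : ‖(1 - s) • p + s • y - c‖ ^ 2 =
        (1 - s) * ‖p - c‖ ^ 2 + s * ‖y - c‖ ^ 2 - s * (1 - s) * ‖y - p‖ ^ 2 := by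
      have h₁ : (1 - s) • p + s • y - c = (1 - s) • (p - c) + s • (y - c) := by module
      have h₂ : y - p = (y - c) - (p - c) := by abel
      rw [h₁, h₂, norm_add_sq_real, norm_sub_sq_real (y - c), norm_smul, norm_smul,
        real_inner_smul_left, real_inner_smul_right, real_inner_comm (p - c), mul_pow, mul_pow,
        Real.norm_eq_abs, Real.norm_eq_abs, sq_abs, sq_abs]
      ring
    have hmin := hp ((1 - s) • p + s • y)
    rw [hnorm] at hmin
    refine le_of_mul_le_mul_left ?_ hs0
    linear_combination hmin + hconv
  have hlim : Filter.Tendsto (fun s : ℝ ↦ g p + τ / 2 * ‖p - c‖ ^ 2 +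
      (1 - s) * (τ / 2 * ‖y - p‖ ^ 2)) (nhdsWithin 0 (Set.Ioi 0))
      (nhds (g p + τ / 2 * ‖p - c‖ ^ 2 + τ / 2 * ‖y - p‖ ^ 2)) := by
    refine (Continuous.tendsto' (by fun_prop) 0 _ (by ring)).mono_left nhdsWithin_le_nhds
  exact le_of_tendsto hlim (Filter.eventually_of_mem (Ioo_mem_nhdsGT one_pos) key)

end

theorem gpgm_one_iteration {n : ℕ}
    (f g : EuclideanSpace ℝ (Fin n) → ℝ)
    (f' : EuclideanSpace ℝ (Fin n) → EuclideanSpace ℝ (Fin n))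
    (L γ : ℝ) (hL : 0 ≤ L) (hγ : 0 < γ) (hα : L / γ ∈ Set.Ioc (0 : ℝ) 1)
    (hdiff : ∀ x, HasGradientAt f (f' x) x)
    (hfconv : ConvexOn ℝ Set.univ f)
    (hgconv : ConvexOn ℝ Set.univ g)
    (hsmooth : ∀ x x', f x' ≤ f x + ⟪f' x, x' - x⟫ + L / 2 * ‖x' - x‖ ^ 2)
    (xstar : EuclideanSpace ℝ (Fin n))
    (hstar : ∀ x, f xstar + g xstar ≤ f x + g x)
    (t θ τ : ℝ) (ht : 1 ≤ t) (hθ : θ = 1 / t) (hτ : τ = γ * θ)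
    (xag xhat xmd xplus xagp : EuclideanSpace ℝ (Fin n))
    (hmd : xmd = (1 - θ) • xag + θ • xhat)
    (hmin : ∀ x : EuclideanSpace ℝ (Fin n),
      g xplus + τ / 2 * ‖xplus - (xhat - (1 / τ) • f' xmd)‖ ^ 2
        ≤ g x + τ / 2 * ‖x - (xhat - (1 / τ) • f' xmd)‖ ^ 2)
    (hagp : xagp = (1 - θ) • xag + θ • xplus) :
    t ^ 2 * ((f xagp + g xagp) - (f xstar + g xstar))
      ≤ t * (t - 1) * ((f xag + g xag) - (f xstar + g xstar))
        + γ / 2 * (‖xhat - xstar‖ ^ 2 - ‖xplus - xstar‖ ^ 2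
            - (1 - L / γ) * ‖xhat - xplus‖ ^ 2) := by
  have ht0 : 0 < t := by linarith
  have hθ0 : 0 < θ := by rw [hθ]; positivity
  have hθ1 : θ ≤ 1 := by rw [hθ]; exact (div_le_one ht0).2 ht
  have hτ0 : 0 < τ := by rw [hτ]; positivity
  have htθ : t * θ = 1 := by rw [hθ]; field_simp
  have hprox := hgconv.prox_three_point hmin xstar
  have hcenter (x : EuclideanSpace ℝ (Fin n)) :
      τ / 2 * ‖x - (xhat - (1 / τ) • f' xmd)‖ ^ 2 =
        τ / 2 * ‖x - xhat‖ ^ 2 + ⟪f' xmd, x - xhat⟫ + τ / 2 * ‖(1 / τ) • f' xmd‖ ^ 2 := by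
    rw [← sub_add, norm_add_sq_real, real_inner_smul_right, real_inner_comm]
    field_simp
  rw [hcenter, hcenter] at hprox
  have hg : g xagp ≤ (1 - θ) * g xag + θ * g xplus := by
    rw [hagp]
    exact hgconv.2 (Set.mem_univ _) (Set.mem_univ _) (by linarith) hθ0.le (by ring)
  have hf := hsmooth xmd xagp
  have hstep : xagp - xmd = θ • (xplus - xhat) := by rw [hagp, hmd]; module
  have hsplit : ⟪f' xmd, θ • (xplus - xhat)⟫ = (1 - θ) * ⟪f' xmd, xag - xmd⟫ +
      θ * (⟪f' xmd, xstar - xmd⟫ + ⟪f' xmd, xplus - xhat⟫ - ⟪f' xmd, xstar - xhat⟫) := by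
    rw [← inner_add_right, ← inner_sub_right, ← real_inner_smul_right, ← real_inner_smul_right,
      ← inner_add_right]
    congr 1
    rw [hmd]
    module
  rw [hstep, hsplit, norm_smul, mul_pow, Real.norm_eq_abs, sq_abs] at hf
  have hag := mul_le_mul_of_nonneg_left (hfconv.add_inner_gradient_le (hdiff xmd) xag)
    (sub_nonneg.2 hθ1)
  have hst := mul_le_mul_of_nonneg_left (hfconv.add_inner_gradient_le (hdiff xmd) xstar) hθ0.le
  have hpr := mul_le_mul_of_nonneg_left hprox hθ0.le
  have hdescent : (f xagp + g xagp) - (f xstar + g xstar) ≤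
      (1 - θ) * ((f xag + g xag) - (f xstar + g xstar)) +
        θ * (τ / 2) * (‖xhat - xstar‖ ^ 2 - ‖xplus - xstar‖ ^ 2 - ‖xhat - xplus‖ ^ 2) +
        L / 2 * (θ ^ 2 * ‖xhat - xplus‖ ^ 2) := by
    rw [norm_sub_rev xhat xstar, norm_sub_rev xplus xstar, norm_sub_rev xhat xplus]
    linear_combination hf + hg + hag + hst + hpr
  refine (mul_le_mul_of_nonneg_left hdescent (sq_nonneg t)).trans_eq ?_
  rw [hτ, hθ]
  field_simp
  ring
end

section
/- (Telescoped GLADMM gap bound.) Let X ⊆ ℝⁿ, Y ⊆ ℝᵐ be closed convex, f : ℝⁿ → ℝ convex differentiable with f(x') ≤ f(x) + ⟨∇f(x), x' − x⟩ + (L/2)‖x' − x‖² for all x, x' (L ≥ 0), g : ℝᵐ → ℝ convex, A ∈ ℝ^{l×n}, B ∈ ℝ^{l×m}, b ∈ ℝˡ, and (x*, y*) ∈ X × Y with B y* − A x* = b. Fix a total iteration count N ≥ 2, γ > 0, α ∈ (0, 1), ξ ∈ [1.5, 2), β = 1/ξ, κ > 1, and for 1 ≤ k ≤ N − 1 set θ_k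 = 2/(k+1), λ_k = τ_k = γN/k, γ_k = (2 − ξ)γk/(κN), η_k = 2L/(αk), ξ_k = ξ. Run GLADMM from x¹ = x̂¹ = x_ag¹ ∈ X, y¹ = ŷ¹ = y_ag¹ ∈ Y with B y¹ = A x¹ + b, and z¹ = ẑ¹ = z_ag¹ = 0, where each iteration is: x_md^k = (1 − θ_k)x_ag^k + θ_k x̂^k; x^{k+1} = argmin_{x ∈ X} ⟨∇f(x_md^k), x⟩ + (λ_k/2)‖B ŷ^k − A x − b‖² + ⟨ẑ^k, A x⟩ + (η_k/2)‖x − x̂^k‖²; x̂^{k+1} = (2 − α)x^{k+1} + (α − 1)x̂^k; x_ag^{k+1} = (1 − θ_k)x_ag^k + θ_k x^{k+1}; y^{k+1} = argmin_{y ∈ Y} g(y) − ⟨ẑ^k, B y⟩ + (τ_k/2)‖B y − A x^{k+1} − b‖²; ŷ^{k+1} = (2 − β)y^{k+1} + (β − 1)ŷ^k; y_ag^{k+1} = (1 − θ_k)y_ag^k + θ_k y^{k+1}; z^{k+1} = ẑ^k − γ_k(B y^{k+1} − A x^{k+1} − b); ẑ^{k+1} = (1 − κ)ẑ^k + κ z^{k+1};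 z_ag^{k+1} = (1 − θ_k)z_ag^k + θ_k z^{k+1}. Then for every z ∈ ℝˡ and every 1 ≤ k ≤ N − 1: Q(x*, y*, z; x_ag^{k+1}, y_ag^{k+1}, z_ag^{k+1}) ≤ (2L‖x¹ − x*‖²)/(α(2 − α)k(k+1)) + (κN‖z‖²)/(γ(2 − ξ)k(k+1)) + (2γN‖B y¹ − B y*‖²)/((2 − β)k(k+1)), where Q(x̃, ỹ, z̃; x, y, z) = [f(x) + g(y) − ⟨z̃, By − Ax − b⟩] − [f(x̃) + g(ỹ) − ⟨z, Bỹ − Ax̃ − b⟩]. -/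
open scoped RealInnerProductSpace

/-- The gap function `Q(x̃, ỹ, z̃; x, y, z)` of the two-block linearly constrained
problem `min f(x) + g(y)  s.t.  B y − A x = b`. -/
noncomputable def gapQ {n m l : ℕ}
    (f : EuclideanSpace ℝ (Fin n) → ℝ) (g : EuclideanSpace ℝ (Fin m) → ℝ)
    (A : Matrix (Fin l) (Fin n) ℝ) (B : Matrix (Fin l) (Fin m) ℝ)
    (b : EuclideanSpace ℝ (Fin l))
    (xt : EuclideanSpace ℝ (Fin n)) (yt : EuclideanSpace ℝ (Fin m))
    (zt : EuclideanSpace ℝ (Fin l))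
    (x : EuclideanSpace ℝ (Fin n)) (y : EuclideanSpace ℝ (Fin m))
    (z : EuclideanSpace ℝ (Fin l)) : ℝ :=
  (f x + g y - ⟪zt, Matrix.toEuclideanLin B y - Matrix.toEuclideanLin A x - b⟫)
    - (f xt + g yt - ⟪z, Matrix.toEuclideanLin B yt - Matrix.toEuclideanLin A xt - b⟫)

section InnerProductLemmas

variable {E F G : Type*} [NormedAddCommGroup E] [InnerProductSpace ℝ E]
  [NormedAddCommGroup F] [InnerProductSpace ℝ F]

lemma nonneg_of_forall_linear_add_quadratic {a c : ℝ}
    (h : ∀ t : ℝ, 0 < t → t ≤ 1 → 0 ≤ t * a + t ^ 2 * c) : 0 ≤ a := by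
  by_contra! ha
  have hc : 0 < |c| + 1 := by positivity
  have ht : 0 < min 1 (-a / (2 * (|c| + 1))) :=
    lt_min one_pos (div_pos (by linarith) (by positivity))
  have h1 := h _ ht (min_le_left _ _)
  have h2 := min_le_right 1 (-a / (2 * (|c| + 1)))
  set t := min 1 (-a / (2 * (|c| + 1)))
  rw [le_div_iff₀ (by positivity)] at h2
  have h3 : 0 ≤ t * (a + t * c) := by linarith
  have h4 : 0 ≤ a + t * c := nonneg_of_mul_nonneg_right h3 ht
  nlinarith [mul_le_mul_of_nonneg_left (le_abs_self c) ht.le]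

/-- First-order convexity inequality for a convex function with a quadratic upper model. -/
lemma ConvexOn.add_inner_le_of_quadratic_upper_bound {f : E → ℝ} {p v : E} {L : ℝ}
    (hf : ConvexOn ℝ Set.univ f)
    (hp : ∀ u, f u ≤ f v + ⟪p, u - v⟫ + L / 2 * ‖u - v‖ ^ 2) (u : E) :
    f v + ⟪p, u - v⟫ ≤ f u := by
  have key : 0 ≤ f u - f v - ⟪p, u - v⟫ := by
    apply nonneg_of_forall_linear_add_quadratic (c := L / 2 * ‖u - v‖ ^ 2)
    intro t ht _
    have h1 := hp (v - t • (u - v))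
    rw [show v - t • (u - v) - v = -(t • (u - v)) by abel, inner_neg_right, inner_smul_right,
      norm_neg, norm_smul, Real.norm_eq_abs, mul_pow, sq_abs] at h1
    have ht1 : (1 + t) ≠ 0 := by positivity
    have h2 := hf.2 (Set.mem_univ (v - t • (u - v))) (Set.mem_univ u)
      (show 0 ≤ 1 / (1 + t) by positivity) (show 0 ≤ t / (1 + t) by positivity) (by field_simp)
    have h3 : (1 / (1 + t)) • (v - t • (u - v)) + (t / (1 + t)) • u = v := by
      match_scalars <;> field_simp <;> ring
    rw [h3, smul_eq_mul, smul_eq_mul, div_mul_eq_mul_div, div_mul_eq_mul_div, ← add_div,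
      le_div_iff₀ (by positivity)] at h2
    nlinarith
  linarith

/-- Variational inequality for the minimizer of a linear-plus-penalty-plus-proximal objective. -/
lemma inner_sub_le_of_isMin_proximal_penalty {X : Set E} (hX : Convex ℝ X) (A : E →ₗ[ℝ] F)
    {p x₁ x₀ xs : E} {v b q : F} {lam η : ℝ} (hx₁ : x₁ ∈ X) (hxs : xs ∈ X)
    (hmin : ∀ x' ∈ X,
      ⟪p, x₁⟫ + lam / 2 * ‖v - A x₁ - b‖ ^ 2 + ⟪q, A x₁⟫ + η / 2 * ‖x₁ - x₀‖ ^ 2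
        ≤ ⟪p, x'⟫ + lam / 2 * ‖v - A x' - b‖ ^ 2 + ⟪q, A x'⟫ + η / 2 * ‖x' - x₀‖ ^ 2) :
    ⟪p, x₁ - xs⟫ ≤ ⟪q, A xs - A x₁⟫ - lam * ⟪v - A x₁ - b, A xs - A x₁⟫
      + η * ⟪x₁ - x₀, xs - x₁⟫ := by
  have key : 0 ≤ ⟪p, xs - x₁⟫ + ⟪q, A xs - A x₁⟫ - lam * ⟪v - A x₁ - b, A xs - A x₁⟫
      + η * ⟪x₁ - x₀, xs - x₁⟫ := by
    apply nonneg_of_forall_linear_add_quadratic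
      (c := lam / 2 * ‖A xs - A x₁‖ ^ 2 + η / 2 * ‖xs - x₁‖ ^ 2)
    intro t ht ht1
    have h := hmin _ (hX.add_smul_sub_mem hx₁ hxs ⟨ht.le, ht1⟩)
    rw [map_add, map_smul, map_sub,
      show v - (A x₁ + t • (A xs - A x₁)) - b = (v - A x₁ - b) - t • (A xs - A x₁) by abel,
      show x₁ + t • (xs - x₁) - x₀ = (x₁ - x₀) + t • (xs - x₁) by abel,
      norm_sub_sq_real (v - A x₁ - b), norm_add_sq_real (x₁ - x₀), inner_add_right,
      inner_add_right, norm_smul, norm_smul, mul_pow, mul_pow] at h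
    simp only [inner_smul_right, Real.norm_eq_abs, sq_abs] at h
    linarith
  rw [← neg_sub xs x₁, inner_neg_right]
  linarith

/-- Variational inequality for the minimizer of a convex-plus-penalty objective. -/
lemma sub_le_of_isMin_penalty {Y : Set E} (hY : Convex ℝ Y) {g : E → ℝ}
    (hg : ConvexOn ℝ Set.univ g) (B : E →ₗ[ℝ] F)
    {y₁ ys : E} {a b q : F} {τ : ℝ} (hy₁ : y₁ ∈ Y) (hys : ys ∈ Y)
    (hmin : ∀ y' ∈ Y,
      g y₁ - ⟪q, B y₁⟫ + τ / 2 * ‖B y₁ - a - b‖ ^ 2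
        ≤ g y' - ⟪q, B y'⟫ + τ / 2 * ‖B y' - a - b‖ ^ 2) :
    g y₁ - g ys ≤ τ * ⟪B y₁ - a - b, B ys - B y₁⟫ - ⟪q, B ys - B y₁⟫ := by
  have key : 0 ≤ g ys - g y₁ - ⟪q, B ys - B y₁⟫ + τ * ⟪B y₁ - a - b, B ys - B y₁⟫ := by
    apply nonneg_of_forall_linear_add_quadratic (c := τ / 2 * ‖B ys - B y₁‖ ^ 2)
    intro t ht ht1
    have h := hmin _ (hY.add_smul_sub_mem hy₁ hys ⟨ht.le, ht1⟩)
    have h2 := hg.2 (Set.mem_univ y₁) (Set.mem_univ ys) (sub_nonneg.2 ht1) ht.le (by ring)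
    rw [show (1 - t) • y₁ + t • ys = y₁ + t • (ys - y₁) by module, smul_eq_mul,
      smul_eq_mul] at h2
    rw [map_add, map_smul, map_sub,
      show B y₁ + t • (B ys - B y₁) - a - b = (B y₁ - a - b) + t • (B ys - B y₁) by abel,
      norm_add_sq_real (B y₁ - a - b), inner_add_right, norm_smul, mul_pow] at h
    simp only [inner_smul_right, Real.norm_eq_abs, sq_abs] at h
    linarith
  linarith

/-- Three-point identity for the over-relaxed update `u ↦ (2 - a) • v + (a - 1) • u`. -/
lemma two_mul_inner_sub_relaxation (a : ℝ) (u v s : E) :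
    2 * (2 - a) * ⟪v - u, s - v⟫ = ‖u - s‖ ^ 2 - ‖(2 - a) • v + (a - 1) • u - s‖ ^ 2
      - a * (2 - a) * ‖v - u‖ ^ 2 := by
  rw [show (2 - a) • v + (a - 1) • u - s = (u - s) + (2 - a) • (v - u) by module,
    show s - v = -((u - s) + (v - u)) by abel, norm_add_sq_real, inner_neg_right,
    inner_add_right, inner_smul_right, norm_smul, mul_pow, Real.norm_eq_abs, sq_abs,
    real_inner_self_eq_norm_sq, real_inner_comm (v - u)]
  ring

/-- One-iteration bound on the coupling terms: multiplier ascent plus the penalty mismatch. -/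
lemma gladmm_coupling_bound {γ ξ M K : ℝ} (hγ : 0 < γ) (hξ : ξ < 2) (hξ' : 1 ≤ ξ)
    (hK : 0 < K) (hKM : K ≤ M) (r q q₁ z c u us u₁ : F)
    (hr : r = u - us + c)
    (hq₁ : q₁ = q - ((2 - ξ) * γ * K / M) • r)
    {w : F} (hw : w = (2 - 1 / ξ) • u + (1 / ξ - 1) • u₁) :
    2 * K * ⟪q - z, r⟫
        + 2 * γ * M * (⟪r, us - u⟫ - ⟪r + (u₁ - u), c⟫)
      ≤ M / ((2 - ξ) * γ) * (‖q - z‖ ^ 2 - ‖q₁ - z‖ ^ 2)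
        + γ * M / (2 - 1 / ξ) * (‖u₁ - us‖ ^ 2 - ‖w - us‖ ^ 2) := by
  have hM : 0 < M := hK.trans_le hKM
  have hξ0 : 0 < ξ := by linarith
  have h2ξ : 0 < 2 - ξ := by linarith
  have hβ : 0 < 2 - 1 / ξ := by
    have : 1 / ξ ≤ 1 := by rw [div_le_one hξ0]; exact hξ'
    linarith
  have hrel := two_mul_inner_sub_relaxation (1 / ξ) u₁ u us
  rw [← hw] at hrel
  have hrel' : γ * M / (2 - 1 / ξ) * (‖u₁ - us‖ ^ 2 - ‖w - us‖ ^ 2)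
      = γ * M * (2 * ⟪u - u₁, us - u⟫ + 1 / ξ * ‖u - u₁‖ ^ 2) := by
    rw [show ‖u₁ - us‖ ^ 2 - ‖w - us‖ ^ 2
      = (2 - 1 / ξ) * (2 * ⟪u - u₁, us - u⟫ + 1 / ξ * ‖u - u₁‖ ^ 2) by linarith,
      ← mul_assoc, div_mul_cancel₀ _ hβ.ne']
  have hdual : M / ((2 - ξ) * γ) * (‖q - z‖ ^ 2 - ‖q₁ - z‖ ^ 2)
      = 2 * K * ⟪q - z, r⟫ - (2 - ξ) * γ * K ^ 2 / M * ‖r‖ ^ 2 := by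
    rw [hq₁, show q - ((2 - ξ) * γ * K / M) • r - z = (q - z) - ((2 - ξ) * γ * K / M) • r by abel,
      norm_sub_sq_real (q - z), inner_smul_right, norm_smul, mul_pow, Real.norm_eq_abs, sq_abs]
    field_simp
    ring
  have hstep : (2 - ξ) * γ * K ^ 2 / M * ‖r‖ ^ 2 ≤ (2 - ξ) * γ * M * ‖r‖ ^ 2 := by
    gcongr
    rw [div_le_iff₀ hM]
    calc (2 - ξ) * γ * K ^ 2 ≤ (2 - ξ) * γ * M ^ 2 := by gcongr
      _ = (2 - ξ) * γ * M * M := by ring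
  have hc : c = r + (us - u) := by rw [hr]; abel
  have hcross : ⟪r, us - u⟫ - ⟪r + (u₁ - u), c⟫
      = -‖r‖ ^ 2 + ⟪u - u₁, r⟫ + ⟪u - u₁, us - u⟫ := by
    rw [hc, ← neg_sub u u₁]
    simp only [inner_add_left, inner_add_right, inner_neg_left, real_inner_self_eq_norm_sq]
    ring
  have hsq : 0 ≤ γ * M * (ξ * ‖r‖ ^ 2 - 2 * ⟪u - u₁, r⟫ + 1 / ξ * ‖u - u₁‖ ^ 2) := by
    apply mul_nonneg (by positivity)
    have h := mul_nonneg (one_div_pos.2 hξ0).le (sq_nonneg ‖(u - u₁) - ξ • r‖)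
    rw [norm_sub_sq_real, inner_smul_right, norm_smul, mul_pow, Real.norm_eq_abs, sq_abs] at h
    convert h using 1
    field_simp
    ring
  rw [hrel', hdual, hcross]
  linarith

/-- Descent of a smooth convex function along an accelerated averaging step. -/
lemma ConvexOn.accelerated_step_le {f : E → ℝ} {L θ : ℝ} (hf : ConvexOn ℝ Set.univ f)
    {p xm xa xh x₁ xs : E}
    (hp : ∀ u, f u ≤ f xm + ⟪p, u - xm⟫ + L / 2 * ‖u - xm‖ ^ 2)
    (hθ0 : 0 ≤ θ) (hθ1 : θ ≤ 1) (hxm : xm = (1 - θ) • xa + θ • xh) :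
    f ((1 - θ) • xa + θ • x₁) ≤ (1 - θ) * f xa + θ * (f xs + ⟪p, x₁ - xs⟫)
      + L / 2 * θ ^ 2 * ‖x₁ - xh‖ ^ 2 := by
  have h1 := hp ((1 - θ) • xa + θ • x₁)
  have ha := mul_le_mul_of_nonneg_left (hf.add_inner_le_of_quadratic_upper_bound hp xa)
    (sub_nonneg.2 hθ1)
  have hs := mul_le_mul_of_nonneg_left (hf.add_inner_le_of_quadratic_upper_bound hp xs) hθ0
  have hsum : ⟪p, (1 - θ) • xa + θ • x₁ - xm⟫
      = (1 - θ) * ⟪p, xa - xm⟫ + θ * ⟪p, xs - xm⟫ + θ * ⟪p, x₁ - xs⟫ := by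
    simp only [inner_sub_right, inner_add_right, inner_smul_right]
    ring
  have hd : (1 - θ) • xa + θ • x₁ - xm = θ • (x₁ - xh) := by rw [hxm]; module
  rw [hsum, hd, norm_smul, mul_pow, Real.norm_eq_abs, sq_abs] at h1
  linarith

end InnerProductLemmas

set_option maxHeartbeats 1600000 in
theorem gladmm_telescoped_gap_bound {n m l : ℕ}
    (X : Set (EuclideanSpace ℝ (Fin n))) (hXcl : IsClosed X) (hXcv : Convex ℝ X)
    (Y : Set (EuclideanSpace ℝ (Fin m))) (hYcl : IsClosed Y) (hYcv : Convex ℝ Y)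
    (f : EuclideanSpace ℝ (Fin n) → ℝ) (g : EuclideanSpace ℝ (Fin m) → ℝ)
    (f' : EuclideanSpace ℝ (Fin n) → EuclideanSpace ℝ (Fin n))
    (L : ℝ) (hL : 0 ≤ L)
    (hdiff : ∀ x, HasGradientAt f (f' x) x)
    (hfconv : ConvexOn ℝ Set.univ f)
    (hgconv : ConvexOn ℝ Set.univ g)
    (hsmooth : ∀ x x', f x' ≤ f x + ⟪f' x, x' - x⟫ + L / 2 * ‖x' - x‖ ^ 2)
    (A : Matrix (Fin l) (Fin n) ℝ) (B : Matrix (Fin l) (Fin m) ℝ)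
    (b : EuclideanSpace ℝ (Fin l))
    (xstar : EuclideanSpace ℝ (Fin n)) (ystar : EuclideanSpace ℝ (Fin m))
    (hstarX : xstar ∈ X) (hstarY : ystar ∈ Y)
    (hstarfeas : Matrix.toEuclideanLin B ystar - Matrix.toEuclideanLin A xstar = b)
    (N : ℕ) (hN : 2 ≤ N)
    (γ α ξ β κ : ℝ) (hγ : 0 < γ) (hα : α ∈ Set.Ioo (0 : ℝ) 1)
    (hξ : ξ ∈ Set.Ico (1.5 : ℝ) 2) (hβ : β = 1 / ξ) (hκ : 1 < κ)
    (x xhat xag xmd : ℕ → EuclideanSpace ℝ (Fin n))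
    (y yhat yag : ℕ → EuclideanSpace ℝ (Fin m))
    (z zhat zag : ℕ → EuclideanSpace ℝ (Fin l))
    (hinitX : x 1 ∈ X) (hinitx1 : x 1 = xhat 1) (hinitx2 : x 1 = xag 1)
    (hinitY : y 1 ∈ Y) (hinity1 : y 1 = yhat 1) (hinity2 : y 1 = yag 1)
    (hinitfeas : Matrix.toEuclideanLin B (y 1) = Matrix.toEuclideanLin A (x 1) + b)
    (hinitz : z 1 = 0) (hinitzhat : zhat 1 = 0) (hinitzag : zag 1 = 0)
    (hmd : ∀ k : ℕ, 1 ≤ k → k + 1 ≤ N →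
      xmd k = (1 - 2 / ((k : ℝ) + 1)) • xag k + (2 / ((k : ℝ) + 1)) • xhat k)
    (hxX : ∀ k : ℕ, 1 ≤ k → k + 1 ≤ N → x (k + 1) ∈ X)
    (hxmin : ∀ k : ℕ, 1 ≤ k → k + 1 ≤ N → ∀ x' ∈ X,
      ⟪f' (xmd k), x (k + 1)⟫
          + (γ * (N : ℝ) / (k : ℝ)) / 2
            * ‖Matrix.toEuclideanLin B (yhat k) - Matrix.toEuclideanLin A (x (k + 1)) - b‖ ^ 2
          + ⟪zhat k, Matrix.toEuclideanLin A (x (k + 1))⟫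
          + (2 * L / (α * (k : ℝ))) / 2 * ‖x (k + 1) - xhat k‖ ^ 2
        ≤ ⟪f' (xmd k), x'⟫
          + (γ * (N : ℝ) / (k : ℝ)) / 2
            * ‖Matrix.toEuclideanLin B (yhat k) - Matrix.toEuclideanLin A x' - b‖ ^ 2
          + ⟪zhat k, Matrix.toEuclideanLin A x'⟫
          + (2 * L / (α * (k : ℝ))) / 2 * ‖x' - xhat k‖ ^ 2)
    (hxhat : ∀ k : ℕ, 1 ≤ k → k + 1 ≤ N →
      xhat (k + 1) = (2 - α) • x (k + 1) + (α - 1) • xhat k)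
    (hxag : ∀ k : ℕ, 1 ≤ k → k + 1 ≤ N →
      xag (k + 1) = (1 - 2 / ((k : ℝ) + 1)) • xag k + (2 / ((k : ℝ) + 1)) • x (k + 1))
    (hyY : ∀ k : ℕ, 1 ≤ k → k + 1 ≤ N → y (k + 1) ∈ Y)
    (hymin : ∀ k : ℕ, 1 ≤ k → k + 1 ≤ N → ∀ y' ∈ Y,
      g (y (k + 1)) - ⟪zhat k, Matrix.toEuclideanLin B (y (k + 1))⟫
          + (γ * (N : ℝ) / (k : ℝ)) / 2
            * ‖Matrix.toEuclideanLin B (y (k + 1)) - Matrix.toEuclideanLin A (x (k + 1)) - b‖ ^ 2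
        ≤ g y' - ⟪zhat k, Matrix.toEuclideanLin B y'⟫
          + (γ * (N : ℝ) / (k : ℝ)) / 2
            * ‖Matrix.toEuclideanLin B y' - Matrix.toEuclideanLin A (x (k + 1)) - b‖ ^ 2)
    (hyhat : ∀ k : ℕ, 1 ≤ k → k + 1 ≤ N →
      yhat (k + 1) = (2 - β) • y (k + 1) + (β - 1) • yhat k)
    (hyag : ∀ k : ℕ, 1 ≤ k → k + 1 ≤ N →
      yag (k + 1) = (1 - 2 / ((k : ℝ) + 1)) • yag k + (2 / ((k : ℝ) + 1)) • y (k + 1))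
    (hz : ∀ k : ℕ, 1 ≤ k → k + 1 ≤ N →
      z (k + 1) = zhat k - ((2 - ξ) * γ * (k : ℝ) / (κ * (N : ℝ)))
        • (Matrix.toEuclideanLin B (y (k + 1)) - Matrix.toEuclideanLin A (x (k + 1)) - b))
    (hzhat : ∀ k : ℕ, 1 ≤ k → k + 1 ≤ N →
      zhat (k + 1) = (1 - κ) • zhat k + κ • z (k + 1))
    (hzag : ∀ k : ℕ, 1 ≤ k → k + 1 ≤ N →
      zag (k + 1) = (1 - 2 / ((k : ℝ) + 1)) • zag k + (2 / ((k : ℝ) + 1)) • z (k + 1)) :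
    ∀ z' : EuclideanSpace ℝ (Fin l), ∀ k : ℕ, 1 ≤ k → k + 1 ≤ N →
      gapQ f g A B b xstar ystar z' (xag (k + 1)) (yag (k + 1)) (zag (k + 1))
        ≤ 2 * L * ‖x 1 - xstar‖ ^ 2 / (α * (2 - α) * (k : ℝ) * ((k : ℝ) + 1))
          + κ * (N : ℝ) * ‖z'‖ ^ 2 / (γ * (2 - ξ) * (k : ℝ) * ((k : ℝ) + 1))
          + 2 * γ * (N : ℝ)
              * ‖Matrix.toEuclideanLin B (y 1) - Matrix.toEuclideanLin B ystar‖ ^ 2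
            / ((2 - β) * (k : ℝ) * ((k : ℝ) + 1)) := by
  intro z' k hk1 hkN
  obtain ⟨hα0, hα1⟩ := hα
  obtain ⟨hξ1, hξ2⟩ := hξ
  have hξ1' : 1 ≤ ξ := by norm_num at hξ1; linarith
  have hβ1 : β ≤ 1 := by rw [hβ, div_le_one (by linarith)]; exact hξ1'
  have h2ξ : 0 < 2 - ξ := by linarith
  have h2β : 0 < 2 - β := by linarith
  have h2α : 0 < 2 - α := by linarith
  have hN0 : (0 : ℝ) < N := by exact_mod_cast (by omega : 0 < N)
  let Q : ℕ → ℝ := fun i ↦ gapQ f g A B b xstar ystar z' (xag i) (yag i) (zag i)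
  let V : ℕ → ℝ := fun i ↦ 2 * L / (α * (2 - α)) * ‖xhat i - xstar‖ ^ 2
    + N / ((2 - ξ) * γ) * ‖zhat i - z'‖ ^ 2
    + γ * N / (2 - β) * ‖Matrix.toEuclideanLin B (yhat i) - Matrix.toEuclideanLin B ystar‖ ^ 2
  have hV0 : ∀ i, 0 ≤ V i := fun i ↦ by positivity
  have hstep : ∀ i : ℕ, 1 ≤ i → i + 1 ≤ N →
      (i : ℝ) * (i + 1) * Q (i + 1) + V (i + 1) ≤ ((i : ℝ) - 1) * i * Q i + V i := by
    intro i hi hiN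
    have hK1 : (1 : ℝ) ≤ i := by exact_mod_cast hi
    have hK0 : (0 : ℝ) < i := by linarith
    have hKN : (i : ℝ) ≤ N := by exact_mod_cast (by omega : i ≤ N)
    have hθ0 : (0 : ℝ) ≤ 2 / (i + 1) := by positivity
    have hθ1 : 2 / ((i : ℝ) + 1) ≤ 1 := by rw [div_le_one (by linarith)]; linarith
    have hx := inner_sub_le_of_isMin_proximal_penalty hXcv (Matrix.toEuclideanLin A)
      (hxX i hi hiN) hstarX (hxmin i hi hiN)
    have hy := sub_le_of_isMin_penalty hYcv hgconv (Matrix.toEuclideanLin B)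
      (hyY i hi hiN) hstarY (hymin i hi hiN)
    have hfs := hfconv.accelerated_step_le (x₁ := x (i + 1)) (xs := xstar)
      (hsmooth (xmd i)) hθ0 hθ1 (hmd i hi hiN)
    have hgs := hgconv.2 (Set.mem_univ (yag i)) (Set.mem_univ (y (i + 1)))
      (sub_nonneg.2 hθ1) hθ0 (by ring)
    rw [← hxag i hi hiN] at hfs
    rw [← hyag i hi hiN, smul_eq_mul, smul_eq_mul] at hgs
    have hprox := two_mul_inner_sub_relaxation α (xhat i) (x (i + 1)) xstar
    rw [← hxhat i hi hiN] at hprox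
    set u := Matrix.toEuclideanLin B (y (i + 1)) with hu
    set us := Matrix.toEuclideanLin B ystar with hus
    set u₁ := Matrix.toEuclideanLin B (yhat i) with hu₁
    set c := Matrix.toEuclideanLin A xstar - Matrix.toEuclideanLin A (x (i + 1)) with hc
    set r := u - Matrix.toEuclideanLin A (x (i + 1)) - b with hr
    have hrc : r = u - us + c := by rw [hr, hc, ← hstarfeas]; abel
    have hw : Matrix.toEuclideanLin B (yhat (i + 1)) = (2 - 1 / ξ) • u + (1 / ξ - 1) • u₁ := by
      rw [hyhat i hi hiN, map_add, map_smul, map_smul, hβ]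
    have hq₁ : zhat (i + 1) = zhat i - ((2 - ξ) * γ * i / N) • r := by
      rw [hzhat i hi hiN, hz i hi hiN, smul_sub, smul_smul,
        show κ * ((2 - ξ) * γ * i / (κ * N)) = (2 - ξ) * γ * i / N by
          field_simp]
      module
    have hcoup := gladmm_coupling_bound hγ hξ2 hξ1' hK0 hKN r (zhat i) (zhat (i + 1)) z' c u us u₁
      hrc hq₁ hw
    have hru : u₁ - Matrix.toEuclideanLin A (x (i + 1)) - b = r + (u₁ - u) := by rw [hr]; abel
    rw [hru] at hx
    have hres : Matrix.toEuclideanLin B (yag (i + 1)) - Matrix.toEuclideanLin A (xag (i + 1)) - b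
        = (1 - 2 / ((i : ℝ) + 1)) • (Matrix.toEuclideanLin B (yag i)
          - Matrix.toEuclideanLin A (xag i) - b) + (2 / ((i : ℝ) + 1)) • r := by
      rw [hyag i hi hiN, hxag i hi hiN, hr, hu]
      simp only [map_add, map_smul]
      module
    have hQ : (i : ℝ) * (i + 1) * Q (i + 1) ≤ ((i : ℝ) - 1) * i * Q i
        + 2 * i * (⟪f' (xmd i), x (i + 1) - xstar⟫ + g (y (i + 1)) - g ystar - ⟪z', r⟫)
        + 2 * L * ‖x (i + 1) - xhat i‖ ^ 2 := by
      have hfeas : us - Matrix.toEuclideanLin A xstar - b = 0 := sub_eq_zero.2 hstarfeas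
      have hθ : 2 / ((i : ℝ) + 1) * (i + 1) = 2 := div_mul_cancel₀ _ (by positivity)
      have hQθ : Q (i + 1) ≤ (1 - 2 / ((i : ℝ) + 1)) * Q i + 2 / ((i : ℝ) + 1)
          * (⟪f' (xmd i), x (i + 1) - xstar⟫ + g (y (i + 1)) - g ystar - ⟪z', r⟫)
          + L / 2 * (2 / ((i : ℝ) + 1)) ^ 2 * ‖x (i + 1) - xhat i‖ ^ 2 := by
        simp only [Q, gapQ]
        rw [← hus, hfeas, hres, inner_add_right, inner_smul_right, inner_smul_right]
        simp only [inner_zero_right]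
        linarith
      generalize 2 / ((i : ℝ) + 1) = θ at hθ hQθ hθ0 hθ1
      have hm := mul_le_mul_of_nonneg_left hQθ (show (0 : ℝ) ≤ i * (i + 1) by positivity)
      have hθi : L * (θ * i) * ‖x (i + 1) - xhat i‖ ^ 2 ≤ L * 2 * ‖x (i + 1) - xhat i‖ ^ 2 := by
        gcongr
        linarith
      refine hm.trans ?_
      generalize Q i = q at *
      generalize ⟪f' (xmd i), x (i + 1) - xstar⟫ + g (y (i + 1)) - g ystar - ⟪z', r⟫ = δ at *
      generalize ‖x (i + 1) - xhat i‖ ^ 2 = d at *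
      calc (i : ℝ) * (i + 1) * ((1 - θ) * q + θ * δ + L / 2 * θ ^ 2 * d)
          = (i * (i + 1) - i * (θ * (i + 1))) * q + i * (θ * (i + 1)) * δ
            + L / 2 * (θ * (i + 1)) * θ * i * d := by ring
        _ = (i - 1) * i * q + 2 * i * δ + L * (θ * i) * d := by rw [hθ]; ring
        _ ≤ _ := by linarith
    have hpx : 4 * L / α * ⟪x (i + 1) - xhat i, xstar - x (i + 1)⟫
        = 2 * L / (α * (2 - α)) * (‖xhat i - xstar‖ ^ 2 - ‖xhat (i + 1) - xstar‖ ^ 2)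
          - 2 * L * ‖x (i + 1) - xhat i‖ ^ 2 := by
      rw [show ‖xhat i - xstar‖ ^ 2 - ‖xhat (i + 1) - xstar‖ ^ 2
        = 2 * (2 - α) * ⟪x (i + 1) - xhat i, xstar - x (i + 1)⟫
          + α * (2 - α) * ‖x (i + 1) - xhat i‖ ^ 2 by linarith]
      generalize ⟪x (i + 1) - xhat i, xstar - x (i + 1)⟫ = a
      generalize ‖x (i + 1) - xhat i‖ ^ 2 = d
      field_simp
      ring
    have hmul : 2 * i * (⟪f' (xmd i), x (i + 1) - xstar⟫ + g (y (i + 1)) - g ystar)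
        ≤ 2 * i * ⟪zhat i, r⟫ + 2 * γ * N * (⟪r, us - u⟫ - ⟪r + (u₁ - u), c⟫)
          + 4 * L / α * ⟪x (i + 1) - xhat i, xstar - x (i + 1)⟫ := by
      have hBc : us - u = c - r := by rw [hrc]; abel
      have hqr : ⟪zhat i, r⟫ = ⟪zhat i, c⟫ - ⟪zhat i, us - u⟫ := by
        rw [hBc, inner_sub_right (zhat i) c r, sub_sub_cancel]
      have hm := mul_le_mul_of_nonneg_left (add_le_add hx hy) (show (0 : ℝ) ≤ 2 * i by positivity)
      rw [hqr]
      refine le_trans (le_of_eq (by ring)) (hm.trans (le_of_eq ?_))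
      field_simp
      ring
    rw [inner_sub_left] at hcoup
    simp only [V, hβ]
    linarith
  have hsum : ∀ i : ℕ, 1 ≤ i → i + 1 ≤ N → (i : ℝ) * (i + 1) * Q (i + 1) + V (i + 1) ≤ V 1 := by
    intro i hi
    induction i, hi using Nat.le_induction with
    | base =>
      intro h
      have := hstep 1 le_rfl h
      norm_num at this ⊢
      linarith
    | succ i hi ih =>
      intro h
      have h1 := hstep (i + 1) (by omega) h
      have h2 := ih (by omega)
      push_cast at h1 ⊢
      linarith
  have hk0 : (0 : ℝ) < k := by exact_mod_cast hk1
  have hfin := hsum k hk1 hkN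
  have hVk := hV0 (k + 1)
  have hV1 : V 1 ≤ 2 * L / (α * (2 - α)) * ‖x 1 - xstar‖ ^ 2 + κ * N / (γ * (2 - ξ)) * ‖z'‖ ^ 2
      + 2 * γ * N / (2 - β)
        * ‖Matrix.toEuclideanLin B (y 1) - Matrix.toEuclideanLin B ystar‖ ^ 2 := by
    simp only [V, ← hinitx1, ← hinity1, hinitzhat, zero_sub, norm_neg, mul_comm (2 - ξ) γ]
    gcongr
    · nlinarith
    · nlinarith
  have hQk : Q (k + 1) ≤ V 1 / (k * (k + 1)) := by
    rw [le_div_iff₀ (by positivity)]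
    linarith
  calc Q (k + 1) ≤ V 1 / (k * (k + 1)) := hQk
    _ ≤ _ := div_le_div_of_nonneg_right hV1 (by positivity)
    _ = _ := by simp only [add_div, div_mul_eq_mul_div, div_div, mul_assoc]
end
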